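/- Let R ≥ 4 be an integer and let q ≥ 4 be a prime power. Then there exists a linear [n, n−2R]_q code with n = Rq + ⌈R/3⌉ whose covering radius equals R and whose minimum distance equals 3. -/

import Mathlib

noncomputable section

/-- `S` is a `ρ`-saturating set of points of the projective space `PG(m-1, F)`
(projectivization of `F^m`): every point lies in the projective subspace generated by
some `ρ+1` points of `S`. -/
def IsSaturating (F : Type*) [Field F] (m ρ : ℕ)
    (S : Set (Projectivization F (Fin m → F))) : Prop :=
  ∀ P : Projectivization F (Fin m → F),
    ∃ p : Fin (ρ + 1) → Projectivization F (Fin m → F),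
      (∀ i, p i ∈ S) ∧
        P.rep ∈ Submodule.span F (Set.range (fun i => (p i).rep))

/-- `B` is a `t`-fold strong blocking set of `PG(m-1, F)`: every `t`-dimensional
linear subspace of `F^m` (i.e. every `(t-1)`-dimensional projective subspace)
is the span of `t` points of `B`. -/
def IsStrongBlocking (F : Type*) [Field F] (m t : ℕ)
    (B : Set (Projectivization F (Fin m → F))) : Prop :=
  ∀ W : Submodule F (Fin m → F), Module.finrank F W = t →
    ∃ p : Fin t → Projectivization F (Fin m → F),
      (∀ i, p i ∈ B) ∧
        Submodule.span F (Set.range (fun i => (p i).rep)) = W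

/-- `B` is a `t`-fold blocking set of `PG(m-1, F)`:
every line meets `B` in at least `t` points. -/
def IsBlocking (F : Type*) [Field F] (m t : ℕ)
    (B : Set (Projectivization F (Fin m → F))) : Prop :=
  ∀ W : Submodule F (Fin m → F), Module.finrank F W = 2 →
    t ≤ {P | P ∈ B ∧ P.rep ∈ W}.ncard

/-- The embedding of the subgeometry `PG(m-1, K)` into `PG(m-1, L)`, induced by applying
the inclusion `K ↪ L` coordinatewise to representative vectors. -/
def subgeom {m : ℕ} (K L : Type*) [Field K] [Field L] [Algebra K L]
    (P : Projectivization K (Fin m → K)) : Projectivization L (Fin m → L) :=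
  Projectivization.mk L (fun i => algebraMap K L (P.rep i))
    (by
      intro h
      apply P.rep_nonzero
      funext i
      have hi : algebraMap K L (P.rep i) = 0 := congrFun h i
      exact (algebraMap K L).injective (by simpa using hi))

/-- The linear code `C` has covering radius exactly `R`: every vector is within Hamming
distance `R` of a codeword, and `R` is the least such value. -/
def IsCovRadius {F : Type*} [Field F] [DecidableEq F] {n : ℕ}
    (C : Submodule F (Fin n → F)) (R : ℕ) : Prop :=
  (∀ x : Fin n → F, ∃ c ∈ C, hammingDist x c ≤ R) ∧
  (∃ x : Fin n → F, ∀ c ∈ C, R ≤ hammingDist x c)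

/-- There exists a linear `[n, n-r]` code over `F` with covering radius `R`. -/
def ExistsCovCode (F : Type*) [Field F] [DecidableEq F] (n r R : ℕ) : Prop :=
  r ≤ n ∧ ∃ C : Submodule F (Fin n → F),
    Module.finrank F C = n - r ∧ IsCovRadius C R

/-- `V_q(n,R)`: the cardinality of a Hamming sphere of radius `R` in `F_q^n`. -/
def sphereCard (q n R : ℕ) : ℕ :=
  ∑ i ∈ Finset.range (R + 1), (q - 1) ^ i * n.choose i

universe u

/-- `φ` is the syndrome map of a linear code with covering radius `R` and minimum distance `3`. -/
structure IsSyndromeMap {F ι V : Type*} [Field F] [DecidableEq F] [Fintype ι] [AddCommGroup V]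
    [Module F V] (φ : (ι → F) →ₗ[F] V) (R : ℕ) : Prop where
  covers : ∀ v, ∃ x, φ x = v ∧ hammingNorm x ≤ R
  exists_deep : ∃ w, ∀ x, φ x = w → R ≤ hammingNorm x
  three_le : ∀ x, φ x = 0 → x ≠ 0 → 3 ≤ hammingNorm x
  exists_eq_three : ∃ x, φ x = 0 ∧ hammingNorm x = 3

section Hamming

variable {F ι κ : Type*} [Field F] [DecidableEq F] [Fintype ι] [Fintype κ]

theorem hammingNorm_sum_type (x : ι ⊕ κ → F) :
    hammingNorm x = hammingNorm (x ∘ Sum.inl) + hammingNorm (x ∘ Sum.inr) := by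
  simp only [hammingNorm, Finset.card_filter, Fintype.sum_sum_type, Function.comp]

theorem hammingNorm_comp_equiv (e : ι ≃ κ) (x : κ → F) :
    hammingNorm (x ∘ e) = hammingNorm x := by
  simp only [hammingNorm, Finset.card_filter, Function.comp]
  exact e.sum_comp fun i => if x i ≠ 0 then 1 else 0

end Hamming

namespace IsSyndromeMap

variable {F : Type*} [Field F] [DecidableEq F]

/-- The syndrome map of the direct sum of two codes. -/
theorem directSum {ι κ V W : Type*} [Fintype ι] [Fintype κ] [AddCommGroup V] [Module F V]
    [AddCommGroup W] [Module F W] {φ : (ι → F) →ₗ[F] V} {ψ : (κ → F) →ₗ[F] W} {R S : ℕ}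
    (hφ : IsSyndromeMap φ R) (hψ : IsSyndromeMap ψ S) :
    IsSyndromeMap ((φ.comp (LinearMap.funLeft F F Sum.inl)).prod
      (ψ.comp (LinearMap.funLeft F F Sum.inr)) : (ι ⊕ κ → F) →ₗ[F] V × W) (R + S) where
  covers := by
    rintro ⟨v, w⟩
    obtain ⟨x, rfl, hx⟩ := hφ.covers v
    obtain ⟨y, rfl, hy⟩ := hψ.covers w
    refine ⟨Sum.elim x y, rfl, ?_⟩
    rw [hammingNorm_sum_type]
    exact add_le_add hx hy
  exists_deep := by
    obtain ⟨v, hv⟩ := hφ.exists_deep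
    obtain ⟨w, hw⟩ := hψ.exists_deep
    refine ⟨(v, w), fun x hx => ?_⟩
    obtain ⟨h₁, h₂⟩ := Prod.ext_iff.1 hx
    rw [hammingNorm_sum_type]
    exact add_le_add (hv _ h₁) (hw _ h₂)
  three_le := by
    intro x hx hx0
    obtain ⟨h₁, h₂⟩ := Prod.ext_iff.1 hx
    rw [hammingNorm_sum_type]
    by_cases h : x ∘ Sum.inl = 0
    · have h' : x ∘ Sum.inr ≠ 0 := by
        intro h'
        apply hx0
        ext (i | i)
        · exact congrFun h i
        · exact congrFun h' i
      exact le_add_left (hψ.three_le _ h₂ h')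
    · exact le_add_right (hφ.three_le _ h₁ h)
  exists_eq_three := by
    obtain ⟨x, hx, hx3⟩ := hφ.exists_eq_three
    refine ⟨Sum.elim x 0, Prod.ext hx (map_zero ψ), ?_⟩
    rw [hammingNorm_sum_type, Sum.elim_comp_inl, Sum.elim_comp_inr, hx3, hammingNorm_zero]

theorem reindex {ι κ V : Type*} [Fintype ι] [Fintype κ] [AddCommGroup V] [Module F V]
    {φ : (ι → F) →ₗ[F] V} {R : ℕ} (hφ : IsSyndromeMap φ R) (e : ι ≃ κ) :
    IsSyndromeMap (φ.comp (LinearMap.funLeft F F e)) R where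
  covers v := by
    obtain ⟨x, rfl, hx⟩ := hφ.covers v
    have hxe : (x ∘ e.symm) ∘ e = x := by ext; simp
    refine ⟨x ∘ e.symm, congrArg φ hxe, ?_⟩
    rwa [hammingNorm_comp_equiv]
  exists_deep := by
    obtain ⟨w, hw⟩ := hφ.exists_deep
    exact ⟨w, fun x hx => (hw (x ∘ e) hx).trans_eq (hammingNorm_comp_equiv e x)⟩
  three_le x hx hx0 := by
    refine (hφ.three_le (x ∘ e) hx fun h => hx0 ?_).trans_eq (hammingNorm_comp_equiv e x)
    ext i
    simpa using congrFun h (e.symm i)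
  exists_eq_three := by
    obtain ⟨x, hx, hx3⟩ := hφ.exists_eq_three
    have hxe : (x ∘ e.symm) ∘ e = x := by ext; simp
    exact ⟨x ∘ e.symm, (congrArg φ hxe).trans hx, by rwa [hammingNorm_comp_equiv]⟩

theorem surjective {ι V : Type*} [Fintype ι] [AddCommGroup V] [Module F V]
    {φ : (ι → F) →ₗ[F] V} {R : ℕ} (hφ : IsSyndromeMap φ R) : Function.Surjective φ :=
  fun v => (hφ.covers v).imp fun _ h => h.1

theorem isCovRadius_ker {n : ℕ} {V : Type*} [AddCommGroup V] [Module F V]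
    {φ : (Fin n → F) →ₗ[F] V} {R : ℕ} (hφ : IsSyndromeMap φ R) :
    IsCovRadius (LinearMap.ker φ) R := by
  constructor
  · intro x
    obtain ⟨y, hy, hyR⟩ := hφ.covers (φ x)
    exact ⟨x - y, by simp [hy], by simpa [hammingDist_comm x, hammingDist_eq_hammingNorm] using hyR⟩
  · obtain ⟨w, hw⟩ := hφ.exists_deep
    obtain ⟨x, rfl⟩ := hφ.surjective w
    refine ⟨x, fun c hc => ?_⟩
    rw [hammingDist_comm, hammingDist_eq_hammingNorm]
    refine hw _ ?_
    rw [LinearMap.mem_ker] at hc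
    rw [neg_add_eq_sub, map_sub, hc, sub_zero]

theorem sInf_hammingDist_ker {n : ℕ} {V : Type*} [AddCommGroup V] [Module F V]
    {φ : (Fin n → F) →ₗ[F] V} {R : ℕ} (hφ : IsSyndromeMap φ R) :
    sInf {d : ℕ | ∃ c₁ ∈ LinearMap.ker φ, ∃ c₂ ∈ LinearMap.ker φ,
      c₁ ≠ c₂ ∧ hammingDist c₁ c₂ = d} = 3 := by
  refine IsLeast.csInf_eq ⟨?_, ?_⟩
  · obtain ⟨x, hx, hx3⟩ := hφ.exists_eq_three
    refine ⟨x, hx, 0, zero_mem _, ?_, by rw [hammingDist_zero_right, hx3]⟩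
    rintro rfl
    simp at hx3
  · rintro d ⟨x, hx, y, hy, hxy, rfl⟩
    rw [LinearMap.mem_ker] at hx hy
    rw [hammingDist_eq_hammingNorm]
    refine hφ.three_le _ ?_ ?_
    · simp [hx, hy]
    · rwa [Ne, neg_add_eq_zero]

theorem finrank_ker {ι V : Type*} [Fintype ι] [AddCommGroup V] [Module F V]
    {φ : (ι → F) →ₗ[F] V} {R : ℕ} (hφ : IsSyndromeMap φ R) :
    Module.finrank F (LinearMap.ker φ) = Fintype.card ι - Module.finrank F V := by
  have h := φ.finrank_range_add_finrank_ker
  rw [LinearMap.range_eq_top.2 hφ.surjective, finrank_top, Module.finrank_pi] at h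
  omega

/-- Criterion, in terms of the columns of a parity check matrix, for covering radius `R` and
minimum distance `3`. -/
theorem of_columns {ι : Type*} [Fintype ι] [Nontrivial ι] {m R : ℕ} {H : ι → Fin m → F}
    (hcov : ∀ v, ∃ (p : Fin R → ι) (c : Fin R → F), ∑ k, c k • H (p k) = v)
    (t : ι → ℕ) (e : Fin R → Fin m) (ht : ∀ i k, H i (e k) ≠ 0 → t i = k)
    (hpair : ∀ i j, ∀ c : F, i ≠ j → H i ≠ c • H j)
    (htriple : ∃ i j k, i ≠ j ∧ i ≠ k ∧ j ≠ k ∧ ∃ a b c : F, a ≠ 0 ∧ b ≠ 0 ∧ c ≠ 0 ∧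
      a • H i + b • H j + c • H k = 0) :
    IsSyndromeMap (Fintype.linearCombination F H) R where
  covers v := by
    classical
    obtain ⟨p, c, rfl⟩ := hcov v
    refine ⟨∑ k, Pi.single (p k) (c k), ?_, ?_⟩
    · simp [map_sum, Fintype.linearCombination_apply_single]
    · have hsub : ({i | (∑ k, Pi.single (p k) (c k) : ι → F) i ≠ 0} : Finset ι) ⊆
          Finset.univ.image p := by
        intro i hi
        rw [Finset.mem_filter_univ, Finset.sum_apply] at hi
        obtain ⟨k, -, hk⟩ := Finset.exists_ne_zero_of_sum_ne_zero hi
        refine Finset.mem_image.2 ⟨k, Finset.mem_univ _, ?_⟩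
        by_contra h
        exact hk (Pi.single_eq_of_ne (Ne.symm h) _)
      refine (Finset.card_le_card hsub).trans (Finset.card_image_le.trans ?_)
      simp
  exists_deep := by
    refine ⟨1, fun x hx => ?_⟩
    have hk (k : Fin R) : ∃ i, x i ≠ 0 ∧ t i = k := by
      have h := congrFun hx (e k)
      rw [Fintype.linearCombination_apply, Finset.sum_apply, Pi.one_apply] at h
      obtain ⟨i, -, hi⟩ := Finset.exists_ne_zero_of_sum_ne_zero (h.trans_ne one_ne_zero)
      rw [Pi.smul_apply, smul_eq_mul] at hi
      exact ⟨i, left_ne_zero_of_mul hi, ht i k (right_ne_zero_of_mul hi)⟩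
    choose i hi hit using hk
    have hinj : Function.Injective i := fun k l h => Fin.ext (by rw [← hit k, ← hit l, h])
    calc R = (Finset.univ.map ⟨i, hinj⟩).card := by simp
      _ ≤ hammingNorm x := Finset.card_le_card fun j hj => by
        obtain ⟨k, -, rfl⟩ := Finset.mem_map.1 hj
        simpa using hi k
  three_le x hx hx0 := by
    classical
    by_contra! hlt
    have hsum : ∑ i with x i ≠ 0, x i • H i = 0 := by
      rw [Fintype.linearCombination_apply] at hx
      rw [← hx]
      refine Finset.sum_subset (Finset.filter_subset _ _) fun i _ hi => ?_
      have : x i = 0 := by simpa using hi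
      rw [this, zero_smul]
    have hpos := hammingNorm_pos_iff.2 hx0
    obtain h | h : hammingNorm x = 1 ∨ hammingNorm x = 2 := by omega
    · obtain ⟨i, hi⟩ := Finset.card_eq_one.1 h
      have hxi : x i ≠ 0 := by
        have : i ∈ ({i | x i ≠ 0} : Finset ι) := hi ▸ Finset.mem_singleton_self i
        simpa using this
      rw [hi, Finset.sum_singleton] at hsum
      obtain ⟨j, hj⟩ := exists_ne i
      apply hpair i j 0 hj.symm
      rw [zero_smul, (smul_eq_zero.1 hsum).resolve_left hxi]
    · obtain ⟨i, j, hij, hs⟩ := Finset.card_eq_two.1 h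
      have hxi : x i ≠ 0 := by
        have : i ∈ ({i | x i ≠ 0} : Finset ι) := hs ▸ Finset.mem_insert_self i _
        simpa using this
      rw [hs, Finset.sum_pair hij, add_eq_zero_iff_eq_neg] at hsum
      apply hpair i j (-(x i)⁻¹ * x j) hij
      rw [← inv_smul_smul₀ hxi (H i), hsum, mul_smul, neg_smul, smul_neg]
  exists_eq_three := by
    classical
    obtain ⟨i, j, k, hij, hik, hjk, a, b, c, ha, hb, hc, h⟩ := htriple
    refine ⟨Pi.single i a + Pi.single j b + Pi.single k c, ?_, ?_⟩
    · simpa [map_add, Fintype.linearCombination_apply_single] using h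
    · rw [hammingNorm, Finset.card_eq_three]
      refine ⟨i, j, k, hij, hik, hjk, ?_⟩
      ext l
      simp only [Finset.mem_filter_univ, Finset.mem_insert, Finset.mem_singleton, Pi.add_apply,
        Pi.single_apply]
      by_cases h₁ : l = i
      · subst h₁
        simp [hij, hik, ha]
      by_cases h₂ : l = j
      · subst h₂
        simp [h₁, hjk, hb]
      by_cases h₃ : l = k
      · subst h₃
        simp [h₁, h₂, hc]
      simp [h₁, h₂, h₃]

end IsSyndromeMap

section Columns

variable {F : Type*} [Field F]

/-- Every affine point off the parabola `y = x ^ 2` lies on a chord of it; this is stated in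
homogeneous form, with points on the parabola allowed. -/
theorem exists_parabola_chord [Fintype F] [DecidableEq F] (hq : 4 ≤ Fintype.card F)
    {α : F} (hα : α ≠ 0) (x y : F) :
    ∃ a b l m : F, l + m = α ∧ l * a + m * b = x ∧ l * a ^ 2 + m * b ^ 2 = y := by
  by_cases hc : x ^ 2 - α * y = 0
  · refine ⟨x / α, 0, α, 0, by simp, by field_simp; simp, ?_⟩
    field_simp
    linear_combination hc
  · set c := (x ^ 2 - α * y) / α ^ 2 with hcdef
    have hc0 : c ≠ 0 := div_ne_zero hc (pow_ne_zero 2 hα)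
    obtain ⟨w, hw0, hwc⟩ : ∃ w : F, w ≠ 0 ∧ w ^ 2 ≠ c := by
      by_cases hs : ∃ s : F, s ^ 2 = c
      · obtain ⟨s, hs⟩ := hs
        have hcard : ({0, s, -s} : Finset F).card < (Finset.univ : Finset F).card :=
          Finset.card_le_three.trans_lt (by rw [Finset.card_univ]; omega)
        obtain ⟨w, -, hw⟩ := Finset.exists_mem_notMem_of_card_lt_card hcard
        simp only [Finset.mem_insert, Finset.mem_singleton, not_or] at hw
        refine ⟨w, hw.1, fun h => ?_⟩
        rcases sq_eq_sq_iff_eq_or_eq_neg.1 (h.trans hs.symm) with h | h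
        exacts [hw.2.1 h, hw.2.2 h]
      · exact ⟨1, one_ne_zero, fun h => hs ⟨1, h⟩⟩
    have hd : w ^ 2 - c ≠ 0 := sub_ne_zero.2 hwc
    have hy : y = (x ^ 2 - c * α ^ 2) / α := by
      rw [hcdef]
      field_simp
      ring
    refine ⟨x / α + w, x / α + c / w, -α * c / (w ^ 2 - c), α * w ^ 2 / (w ^ 2 - c), ?_, ?_, ?_⟩
    · field_simp
      ring
    · field_simp
      ring
    · rw [hy]
      field_simp
      ring

/-- The columns `(1,0,a,a²)`, `(0,1,0,c)`, `(0,0,1,0)`. -/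
def columnsTwo : F ⊕ F ⊕ Unit → Fin 4 → F
  | .inl a => ![1, 0, a, a ^ 2]
  | .inr (.inl c) => ![0, 1, 0, c]
  | .inr (.inr _) => ![0, 0, 1, 0]

/-- The columns `(1,0,0,a,a²,0)`, `(0,1,0,0,b,b²+b)`, `(0,0,1,0,0,c)`, `(0,0,0,1,0,1)`. -/
def columnsThree : F ⊕ F ⊕ F ⊕ Unit → Fin 6 → F
  | .inl a => ![1, 0, 0, a, a ^ 2, 0]
  | .inr (.inl b) => ![0, 1, 0, 0, b, b ^ 2 + b]
  | .inr (.inr (.inl c)) => ![0, 0, 1, 0, 0, c]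
  | .inr (.inr (.inr _)) => ![0, 0, 0, 1, 0, 1]

theorem columnsTwo_covers [Fintype F] [DecidableEq F] (hq : 4 ≤ Fintype.card F) (v : Fin 4 → F) :
    ∃ (p : Fin 2 → F ⊕ F ⊕ Unit) (c : Fin 2 → F), ∑ k, c k • columnsTwo (p k) = v := by
  suffices h : ∃ i j, ∃ x y : F, x • columnsTwo i + y • columnsTwo j = v by
    obtain ⟨i, j, x, y, h⟩ := h
    exact ⟨![i, j], ![x, y], by simpa [Fin.sum_univ_succ] using h⟩
  obtain ⟨α, γ, s, t, rfl⟩ : ∃ α γ s t, v = ![α, γ, s, t] :=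
    ⟨v 0, v 1, v 2, v 3, by ext k; fin_cases k <;> rfl⟩
  by_cases hα : α = 0
  · subst hα
    by_cases hγ : γ = 0
    · subst hγ
      by_cases hs : s = 0
      · subst hs
        refine ⟨.inr (.inl 1), .inr (.inl 0), t, -t, ?_⟩
        ext k; fin_cases k <;> simp [columnsTwo]
      by_cases ht : t = 0
      · subst ht
        refine ⟨.inr (.inr ()), .inl 0, s, 0, ?_⟩
        ext k; fin_cases k <;> simp [columnsTwo]
      refine ⟨.inl (t / s), .inl 0, s ^ 2 / t, -(s ^ 2 / t), ?_⟩
      ext k; fin_cases k <;> simp [columnsTwo] <;> field_simp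
    · refine ⟨.inr (.inr ()), .inr (.inl (t / γ)), s, γ, ?_⟩
      ext k; fin_cases k <;> simp [columnsTwo] <;> field_simp
  by_cases hγ : γ = 0
  · subst hγ
    obtain ⟨a, b, l, m, h₀, h₁, h₂⟩ := exists_parabola_chord hq hα s t
    refine ⟨.inl a, .inl b, l, m, ?_⟩
    ext k; fin_cases k <;> simp [columnsTwo, h₀, h₁, h₂]
  · refine ⟨.inl (s / α), .inr (.inl ((t - s ^ 2 / α) / γ)), α, γ, ?_⟩
    ext k; fin_cases k <;> simp [columnsTwo] <;> field_simp <;> ring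

theorem columnsThree_covers [Fintype F] [DecidableEq F] (hq : 4 ≤ Fintype.card F)
    (v : Fin 6 → F) :
    ∃ (p : Fin 3 → F ⊕ F ⊕ F ⊕ Unit) (c : Fin 3 → F), ∑ k, c k • columnsThree (p k) = v := by
  suffices h : ∃ i j k, ∃ x y z : F,
      x • columnsThree i + y • columnsThree j + z • columnsThree k = v by
    obtain ⟨i, j, k, x, y, z, h⟩ := h
    exact ⟨![i, j, k], ![x, y, z], by simpa [Fin.sum_univ_succ, add_assoc] using h⟩
  obtain ⟨α, β, γ, r, s, t, rfl⟩ : ∃ α β γ r s t, v = ![α, β, γ, r, s, t] :=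
    ⟨v 0, v 1, v 2, v 3, v 4, v 5, by ext k; fin_cases k <;> rfl⟩
  by_cases hα : α = 0
  · subst hα
    by_cases hβ : β = 0
    · subst hβ
      by_cases hγ : γ = 0
      · subst hγ
        by_cases hs : s = 0
        · subst hs
          refine ⟨.inr (.inr (.inr ())), .inr (.inr (.inl 1)), .inr (.inr (.inl 0)),
            r, t - r, r - t, ?_⟩
          ext k; fin_cases k <;> simp [columnsThree]
        by_cases hw : r - t = 0
        · obtain rfl := sub_eq_zero.1 hw
          refine ⟨.inr (.inr (.inr ())), .inr (.inl 0), .inr (.inl (-1)), r, s, -s, ?_⟩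
          ext k; fin_cases k <;> simp [columnsThree]
        refine ⟨.inr (.inr (.inr ())), .inl (s / (r - t)), .inl 0,
          t, (r - t) ^ 2 / s, -((r - t) ^ 2 / s), ?_⟩
        ext k; fin_cases k <;> simp [columnsThree] <;> field_simp <;> ring
      by_cases hr : r = 0
      · subst hr
        refine ⟨.inr (.inl 1), .inr (.inl 0), .inr (.inr (.inl ((t - 2 * s) / γ))),
          s, -s, γ, ?_⟩
        ext k; fin_cases k <;> simp [columnsThree] <;> field_simp <;> ring
      by_cases hs : s = 0
      · subst hs
        refine ⟨.inr (.inr (.inr ())), .inr (.inr (.inl ((t - r) / γ))), .inl 0, r, γ, 0, ?_⟩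
        ext k; fin_cases k <;> simp [columnsThree] <;> field_simp <;> ring
      refine ⟨.inl (s / r), .inl 0, .inr (.inr (.inl (t / γ))),
        r ^ 2 / s, -(r ^ 2 / s), γ, ?_⟩
      ext k; fin_cases k <;> simp [columnsThree] <;> field_simp
    by_cases hγ : γ = 0
    · subst hγ
      obtain ⟨a, b, l, m, h₀, h₁, h₂⟩ := exists_parabola_chord hq hβ s (t - r - s)
      refine ⟨.inr (.inr (.inr ())), .inr (.inl a), .inr (.inl b), r, l, m, ?_⟩
      ext k; fin_cases k <;> simp [columnsThree, h₀, h₁]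
      linear_combination h₁ + h₂
    · refine ⟨.inr (.inr (.inr ())), .inr (.inl (s / β)),
        .inr (.inr (.inl ((t - r - s ^ 2 / β - s) / γ))), r, β, γ, ?_⟩
      ext k; fin_cases k <;> simp [columnsThree] <;> field_simp <;> ring
  by_cases hβ : β = 0
  · subst hβ
    by_cases hγ : γ = 0
    · subst hγ
      obtain ⟨a, b, l, m, h₀, h₁, h₂⟩ := exists_parabola_chord hq hα (r - t) s
      refine ⟨.inl a, .inl b, .inr (.inr (.inr ())), l, m, t, ?_⟩
      ext k; fin_cases k <;> simp [columnsThree, h₀, h₁, h₂]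
    · obtain ⟨a, b, l, m, h₀, h₁, h₂⟩ := exists_parabola_chord hq hα r s
      refine ⟨.inl a, .inl b, .inr (.inr (.inl (t / γ))), l, m, γ, ?_⟩
      ext k; fin_cases k <;> simp [columnsThree, h₀, h₁, h₂] <;> field_simp
  by_cases hγ : γ = 0
  · subst hγ
    obtain ⟨a, b, l, m, h₀, h₁, h₂⟩ :=
      exists_parabola_chord hq hβ (s - r ^ 2 / α) (t - (s - r ^ 2 / α))
    have h₃ : α * (r / α) ^ 2 = r ^ 2 / α := by field_simp
    have h₄ : α * (r / α) = r := by field_simp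
    refine ⟨.inl (r / α), .inr (.inl a), .inr (.inl b), α, l, m, ?_⟩
    ext k; fin_cases k <;> simp [columnsThree, h₀, h₄]
    · linear_combination h₃ + h₁
    · linear_combination h₁ + h₂
  · refine ⟨.inl (r / α), .inr (.inl ((s - r ^ 2 / α) / β)), .inr (.inr (.inl
      ((t - β * (((s - r ^ 2 / α) / β) ^ 2 + (s - r ^ 2 / α) / β)) / γ))), α, β, γ, ?_⟩
    ext k; fin_cases k <;> simp [columnsThree] <;> field_simp <;> ring

theorem exists_ne_zero_ne_one [Fintype F] [DecidableEq F] (hq : 4 ≤ Fintype.card F) :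
    ∃ t : F, t ≠ 0 ∧ t ≠ 1 := by
  have hcard : ({0, 1} : Finset F).card < (Finset.univ : Finset F).card :=
    Finset.card_le_two.trans_lt (by rw [Finset.card_univ]; omega)
  obtain ⟨t, -, ht⟩ := Finset.exists_mem_notMem_of_card_lt_card hcard
  exact ⟨t, by simpa using ht⟩

theorem isSyndromeMap_columnsTwo [Fintype F] [DecidableEq F] (hq : 4 ≤ Fintype.card F) :
    IsSyndromeMap (Fintype.linearCombination F (columnsTwo (F := F))) 2 := by
  have : Nontrivial (F ⊕ F ⊕ Unit) := ⟨.inl 0, .inl 1, by simp⟩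
  refine .of_columns (columnsTwo_covers hq) (Sum.elim (fun _ => 0) fun _ => 1) ![0, 1] ?_ ?_ ?_
  · rintro (a | c | _) k <;> fin_cases k <;> simp [columnsTwo]
  · rintro (a | a | _) (b | b | _) c hij h <;>
      have h₀ := congrFun h 0 <;> have h₁ := congrFun h 1 <;> have h₂ := congrFun h 2 <;>
      have h₃ := congrFun h 3 <;> simp [columnsTwo] at hij h₀ h₁ h₂ h₃
    all_goals grind
  · obtain ⟨t, ht0, ht1⟩ := exists_ne_zero_ne_one hq
    refine ⟨.inr (.inl 0), .inr (.inl 1), .inr (.inl t), by simp, by simpa using ht0.symm,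
      by simpa using ht1.symm, t - 1, -t, 1, sub_ne_zero.2 ht1, neg_ne_zero.2 ht0, one_ne_zero, ?_⟩
    ext k; fin_cases k <;> simp [columnsTwo] <;> ring

theorem isSyndromeMap_columnsThree [Fintype F] [DecidableEq F] (hq : 4 ≤ Fintype.card F) :
    IsSyndromeMap (Fintype.linearCombination F (columnsThree (F := F))) 3 := by
  have : Nontrivial (F ⊕ F ⊕ F ⊕ Unit) := ⟨.inl 0, .inl 1, by simp⟩
  refine .of_columns (columnsThree_covers hq)
    (Sum.elim (fun _ => 0) (Sum.elim (fun _ => 1) fun _ => 2)) ![0, 1, 2] ?_ ?_ ?_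
  · rintro (a | b | c | _) k <;> fin_cases k <;> simp [columnsThree]
  · rintro (a | a | a | _) (b | b | b | _) c hij h <;>
      have h₀ := congrFun h 0 <;> have h₁ := congrFun h 1 <;> have h₂ := congrFun h 2 <;>
      have h₃ := congrFun h 3 <;> have h₄ := congrFun h 4 <;> have h₅ := congrFun h 5 <;>
      simp [columnsThree] at hij h₀ h₁ h₂ h₃ h₄ h₅
    all_goals grind
  · obtain ⟨t, ht0, ht1⟩ := exists_ne_zero_ne_one hq
    refine ⟨.inr (.inr (.inl 0)), .inr (.inr (.inl 1)), .inr (.inr (.inl t)), by simp,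
      by simpa using ht0.symm, by simpa using ht1.symm, t - 1, -t, 1, sub_ne_zero.2 ht1,
      neg_ne_zero.2 ht0, one_ne_zero, ?_⟩
    ext k; fin_cases k <;> simp [columnsThree] <;> ring

end Columns

/-- There is a linear `[n, n - 2R]` code over `F` with covering radius `R` and minimum
distance `3`, given by its syndrome map. -/
def ExistsSyndromeMap (F : Type u) [Field F] [DecidableEq F] (n R : ℕ) : Prop :=
  ∃ (ι V : Type u) (_ : Fintype ι) (_ : AddCommGroup V) (_ : Module F V)
    (φ : (ι → F) →ₗ[F] V),
    Fintype.card ι = n ∧ Module.Finite F V ∧ Module.finrank F V = 2 * R ∧ IsSyndromeMap φ R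

theorem ExistsSyndromeMap.add {F : Type u} [Field F] [DecidableEq F] {n m R S : ℕ}
    (h : ExistsSyndromeMap F n R) (h' : ExistsSyndromeMap F m S) :
    ExistsSyndromeMap F (n + m) (R + S) := by
  obtain ⟨ι, V, _, _, _, φ, rfl, _, hV, hφ⟩ := h
  obtain ⟨κ, W, _, _, _, ψ, rfl, _, hW, hψ⟩ := h'
  exact ⟨ι ⊕ κ, V × W, inferInstance, inferInstance, inferInstance, _, Fintype.card_sum,
    inferInstance, by rw [Module.finrank_prod, hV, hW, mul_add], hφ.directSum hψ⟩

theorem existsSyndromeMap {F : Type u} [Field F] [Fintype F] [DecidableEq F]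
    (hq : 4 ≤ Fintype.card F) :
    ∀ R, 2 ≤ R → ExistsSyndromeMap F (R * Fintype.card F + (R + 2) / 3) R
  | 0, h | 1, h => by omega
  | 2, _ => ⟨_, _, _, _, _, _, by simp; ring, inferInstance, by simp, isSyndromeMap_columnsTwo hq⟩
  | 3, _ => ⟨_, _, _, _, _, _, by simp; ring, inferInstance, by simp,
      isSyndromeMap_columnsThree hq⟩
  | 4, _ => by
    convert (existsSyndromeMap hq 2 le_rfl).add (existsSyndromeMap hq 2 le_rfl) using 1
    ring
  | R + 5, _ => by
    convert (existsSyndromeMap hq (R + 2) (by omega)).add (existsSyndromeMap hq 3 (by omega)) using 1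
    have h : (R + 5 + 2) / 3 = (R + 2 + 2) / 3 + 1 := by omega
    rw [h]
    ring

/-- Theorem 24. For `R ≥ 4` and `q ≥ 4` there exists a linear
`[n, n-2R]_q` code with `n = Rq + ⌈R/3⌉`, covering radius `R` and minimum distance `3`. -/
theorem statement17 (R : ℕ) (hR : 4 ≤ R)
    (F : Type*) [Field F] [Fintype F] [DecidableEq F]
    (hq : 4 ≤ Fintype.card F) :
    ∃ C : Submodule F (Fin (R * Fintype.card F + (R + 2) / 3) → F),
      Module.finrank F C = R * Fintype.card F + (R + 2) / 3 - 2 * R ∧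
      IsCovRadius C R ∧
      sInf {d : ℕ | ∃ c₁ ∈ C, ∃ c₂ ∈ C, c₁ ≠ c₂ ∧ hammingDist c₁ c₂ = d} = 3 := by
  obtain ⟨ι, V, _, _, _, φ, hn, _, hV, hφ⟩ := existsSyndromeMap hq R (by omega)
  have hψ := hφ.reindex (Fintype.equivFinOfCardEq hn)
  refine ⟨_, ?_, hψ.isCovRadius_ker, hψ.sInf_hammingDist_ker⟩
  rw [hψ.finrank_ker, Fintype.card_fin, hV]
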